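/- For every binary string x ∈ {0,1}^n and every y ∈ D_2(x), at least one of the four strings 0000, 1111, 11011, 110011 is preserved from x to y. -/

import Mathlib

/-- Delete from `x` the symbols at the positions in `S`. -/
def deleteIdxs (x : List Bool) (S : Finset ℕ) : List Bool :=
  ((List.range x.length).filter (fun i => decide (i ∉ S))).map (fun i => x.getD i false)

/-- `w` occurs in `x` at position `i`. -/
def occursAt (w x : List Bool) (i : ℕ) : Prop := w <+: x.drop i

/-- The number of (possibly overlapping) occurrences of `w` in `x`. -/
def Nw (w x : List Bool) : ℕ :=
  ((Finset.range x.length).filter (fun i => w <+: x.drop i)).card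

/-- The position in the shortened string of the junction produced by deleting position `k`. -/
def junction (S : Finset ℕ) (k : ℕ) : ℕ :=
  ((Finset.range k).filter (fun m => m ∉ S)).card

/-- `w` is preserved from `x` to `y`: some set `S` of deleted positions realizing `y`
destroys no occurrence of `w` in `x` and no occurrence of `w` in `y` spans a junction. -/
def Preserved (w x y : List Bool) : Prop :=
  ∃ S : Finset ℕ,
    (∀ k ∈ S, k < x.length) ∧
    S.card + y.length = x.length ∧
    deleteIdxs x S = y ∧
    (∀ i, occursAt w x i → ∀ k ∈ S, ¬ (i ≤ k ∧ k < i + w.length)) ∧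
    (∀ j, occursAt w y j → ∀ k ∈ S, ¬ (j < junction S k ∧ junction S k < j + w.length))

/-- `x` has a (maximal) run of length `ℓ` starting at position `i`. -/
def runAt (x : List Bool) (i ℓ : ℕ) : Prop :=
  0 < ℓ ∧ i + ℓ ≤ x.length ∧
  (∀ j, i ≤ j → j < i + ℓ → x.getD j false = x.getD i false) ∧
  (i = 0 ∨ x.getD (i - 1) false ≠ x.getD i false) ∧
  (i + ℓ = x.length ∨ x.getD (i + ℓ) false ≠ x.getD i false)

/-- position `k` of `x` lies in a run of length `ℓ`. -/
def inRun (x : List Bool) (k ℓ : ℕ) : Prop := ∃ i, runAt x i ℓ ∧ i ≤ k ∧ k < i + ℓ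

def w0000 : List Bool := [false, false, false, false]
def w1111 : List Bool := [true, true, true, true]
def w11011 : List Bool := [true, true, false, true, true]
def w110011 : List Bool := [true, true, false, false, true, true]

/-- The set of strings obtainable from `x` by deleting two symbols. -/
def D2 (x : List Bool) : Set (List Bool) :=
  { y | ∃ i j : ℕ, i < j ∧ j < x.length ∧ y = deleteIdxs x ({i, j} : Finset ℕ) }

/-- run-length representation of the runs of ones, in order. -/
def tau1 (x : List Bool) : List ℕ :=
  ((x.splitBy (· == ·)).filter (fun r => r.headD false)).map List.length

/-- the subsequence of `tau1` of entries at least 2. -/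
def tauGe2 (x : List Bool) : List ℕ := (tau1 x).filter (fun ℓ => decide (2 ≤ ℓ))

/-- sum of the odd-indexed entries. -/
def oddIdxSum (l : List ℕ) : ℕ :=
  ((Finset.range l.length).filter (fun i => i % 2 = 1)).sum (fun i => l.getD i 0)

/-- The position in `x` of the `m`-th symbol that survives the deletion of positions `i < k`. -/
def keptIdx (i k m : ℕ) : ℕ := if m < i then m else if m + 1 < k then m + 1 else m + 2

/-- The word `w`, read in `X` along consecutive positions (before or after deleting `i < k`),
meets one of the two deletions. -/
def Kills (X : ℕ → Bool) (i k : ℕ) (w : List Bool) : Prop :=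
  ∃ a, ((∀ t < w.length, X (a + t) = w.getD t false) ∧
      (a ≤ i ∧ i < a + w.length ∨ a ≤ k ∧ k < a + w.length)) ∨
    ((∀ t < w.length, X (keptIdx i k (a + t)) = w.getD t false) ∧
      (a < i ∧ i < a + w.length ∨ a < k - 1 ∧ k - 1 < a + w.length))

theorem getElem?_of_occursAt {w x : List Bool} {a t : ℕ} (h : occursAt w x a)
    (ht : t < w.length) : x[a + t]? = some (w.getD t false) := by
  obtain ⟨r, hr⟩ := h
  rw [← List.getElem?_drop, ← hr, List.getElem?_append_left ht]
  simp [List.getD, ht]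

theorem filter_range_pair {n i k : ℕ} (hik : i < k) (hk : k < n) :
    (List.range n).filter (fun m => decide (m ∉ ({i, k} : Finset ℕ))) =
      (List.range (n - 2)).map (keptIdx i k) := by
  apply List.Perm.eq_of_pairwise (le := (· < ·))
  · intro a b _ _ h₁ h₂
    omega
  · exact List.Pairwise.filter _ List.pairwise_lt_range
  · rw [List.pairwise_map]
    refine List.pairwise_lt_range.imp ?_
    intro a b h
    unfold keptIdx
    split_ifs <;> omega
  · rw [List.perm_ext_iff_of_nodup (List.nodup_range.filter _)]
    · intro m
      simp only [List.mem_filter, List.mem_range, List.mem_map, decide_eq_true_eq,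
        Finset.mem_insert, Finset.mem_singleton]
      constructor
      · rintro ⟨h₁, h₂⟩
        refine ⟨if m < i then m else if m < k then m - 1 else m - 2, ?_, ?_⟩
        · split_ifs <;> omega
        · unfold keptIdx
          split_ifs <;> omega
      · rintro ⟨a, h, rfl⟩
        unfold keptIdx
        split_ifs <;> omega
    · refine List.nodup_range.map ?_
      intro a b h
      unfold keptIdx at h
      split_ifs at h <;> omega

theorem deleteIdxs_pair {x : List Bool} {i k : ℕ} (hik : i < k) (hk : k < x.length) :
    deleteIdxs x {i, k} =
      (List.range (x.length - 2)).map (fun m => x.getD (keptIdx i k m) false) := by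
  rw [deleteIdxs, filter_range_pair hik hk, List.map_map]
  rfl

theorem junction_pair_left {i k : ℕ} (hik : i < k) : junction {i, k} i = i := by
  rw [junction, Finset.filter_true_of_mem, Finset.card_range]
  intro m hm
  simp only [Finset.mem_range] at hm
  simp only [Finset.mem_insert, Finset.mem_singleton]
  omega

theorem junction_pair_right {i k : ℕ} (hik : i < k) : junction {i, k} k = k - 1 := by
  have h : (Finset.range k).filter (fun m => m ∉ ({i, k} : Finset ℕ)) =
      (Finset.range k).erase i := by
    ext m
    simp only [Finset.mem_filter, Finset.mem_range, Finset.mem_insert, Finset.mem_singleton,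
      Finset.mem_erase]
    omega
  rw [junction, h, Finset.card_erase_of_mem (Finset.mem_range.2 hik), Finset.card_range]

theorem kills_of_not_preserved {w x : List Bool} {i k : ℕ} (hik : i < k) (hk : k < x.length)
    (h : ¬ Preserved w x (deleteIdxs x {i, k})) :
    Kills (fun p => x.getD p false) i k w := by
  by_contra hK
  refine h ⟨{i, k}, ?_, ?_, rfl, ?_, ?_⟩
  · simp only [Finset.mem_insert, Finset.mem_singleton]
    omega
  · rw [deleteIdxs_pair hik hk, Finset.card_pair hik.ne, List.length_map, List.length_range]
    omega
  · intro a ha s hs hlt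
    refine hK ⟨a, Or.inl ⟨fun t ht => ?_, ?_⟩⟩
    · simp [List.getD_eq_getElem?_getD, getElem?_of_occursAt ha ht]
    · rcases Finset.mem_insert.1 hs with rfl | hs
      · exact Or.inl hlt
      · rw [Finset.mem_singleton] at hs
        exact Or.inr (hs ▸ hlt)
  · intro a ha s hs hlt
    refine hK ⟨a, Or.inr ⟨fun t ht => ?_, ?_⟩⟩
    · have h₁ := getElem?_of_occursAt ha ht
      rw [deleteIdxs_pair hik hk, List.getElem?_map, Option.map_eq_some_iff] at h₁
      obtain ⟨m, hm, h₂⟩ := h₁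
      obtain ⟨-, rfl⟩ := by simpa [List.getElem?_eq_some_iff] using hm
      exact h₂
    · rcases Finset.mem_insert.1 hs with rfl | hs
      · rw [junction_pair_left hik] at hlt
        exact Or.inl hlt
      · rw [Finset.mem_singleton] at hs
        rw [hs, junction_pair_right hik] at hlt
        exact Or.inr hlt

/-- The bits of `X` within distance five of positions `i < k`, moved so that `i` lands at `5` and
`k` at `5 + d`. -/
def recenter (X : ℕ → Bool) (i k d t : ℕ) : Bool :=
  if t ≤ 10 then (if t + i < 5 then false else X (t + i - 5)) else X (t + k - d - 5)

theorem Kills.recenter {X : ℕ → Bool} {i k : ℕ} {w : List Bool} (hw : w.length ≤ 6)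
    (hik : i < k) (h : Kills X i k w) :
    Kills (recenter X i k (min (k - i) 11)) 5 (5 + min (k - i) 11) w := by
  have near_left : ∀ p q, p + i = q + 5 → p ≤ 10 →
      _root_.recenter X i k (min (k - i) 11) p = X q := by
    intro p q h₁ h₂
    rw [_root_.recenter, if_pos h₂, if_neg (by omega)]
    congr 1
    omega
  have near_right : ∀ p q, p + k = q + 5 + min (k - i) 11 → k - i ≤ 11 ∨ k ≤ q + 5 →
      _root_.recenter X i k (min (k - i) 11) p = X q := by
    intro p q h₁ h₂
    by_cases h₃ : p ≤ 10
    · exact near_left p q (by omega) h₃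
    · rw [_root_.recenter, if_neg h₃]
      congr 1
      omega
  obtain ⟨a, ⟨hX, h | h⟩ | ⟨hX, h | h⟩⟩ := h
  · refine ⟨a + 5 - i, Or.inl ⟨fun t ht => ?_, Or.inl (by omega)⟩⟩
    rw [← hX t ht]
    exact near_left _ _ (by omega) (by omega)
  · refine ⟨a + 5 + min (k - i) 11 - k, Or.inl ⟨fun t ht => ?_, Or.inr (by omega)⟩⟩
    rw [← hX t ht]
    exact near_right _ _ (by omega) (by omega)
  · refine ⟨a + 5 - i, Or.inr ⟨fun t ht => ?_, Or.inl (by omega)⟩⟩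
    rw [← hX t ht]
    by_cases hd : k - i ≤ 11
    · refine near_right _ _ ?_ ?_ <;> unfold keptIdx <;> split_ifs <;> omega
    · refine near_left _ _ ?_ ?_ <;> unfold keptIdx <;> split_ifs <;> omega
  · refine ⟨a + 5 + min (k - i) 11 - k, Or.inr ⟨fun t ht => ?_, Or.inr (by omega)⟩⟩
    rw [← hX t ht]
    refine near_right _ _ ?_ ?_ <;> unfold keptIdx <;> split_ifs <;> omega

/-- A partial assignment of bits to positions: the masks of the positions that must carry `true`
and of those that must carry `false`. -/
abbrev Cube := ℕ × ℕ

/-- `Y` extends the partial assignment `c`. -/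
def Cube.Sat (Y : ℕ → Bool) (c : Cube) : Prop :=
  ∀ p, (c.1.testBit p = true → Y p = true) ∧ (c.2.testBit p = true → Y p = false)

/-- `f n`, with `n` evaluated first when the kernel reduces this term. -/
def forceNat (n : ℕ) (f : ℕ → Bool) : Bool :=
  match n with
  | 0 => f 0
  | m + 1 => f (m + 1)

theorem forceNat_eq (n : ℕ) (f : ℕ → Bool) : forceNat n f = f n := by
  cases n <;> rfl

/-- `f l`, with all entries of `l` evaluated first when the kernel reduces this term. -/
def forceCubes : List Cube → (List Cube → Bool) → Bool
  | [], f => f []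
  | c :: l, f => forceNat c.1 fun a => forceNat c.2 fun b => forceCubes l fun l' => f ((a, b) :: l')

theorem forceCubes_eq : ∀ (l : List Cube) (f : List Cube → Bool), forceCubes l f = f l
  | [], _ => rfl
  | c :: l, f => by rw [forceCubes, forceNat_eq, forceNat_eq, forceCubes_eq l]

/-- No choice of one cube from each list is consistent with the cube `(a, b)`. -/
def refute : List (List Cube) → ℕ → ℕ → Bool
  | [], a, b => Nat.land a b != 0
  | D :: Ds, a, b => Nat.land a b != 0 ||
      D.all fun c => forceNat (Nat.lor c.1 a) fun a' => forceNat (Nat.lor c.2 b) fun b' =>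
        refute Ds a' b'

theorem Cube.Sat.land_eq_zero {Y : ℕ → Bool} {a b : ℕ} (h : Cube.Sat Y (a, b)) :
    Nat.land a b = 0 := by
  refine Nat.eq_of_testBit_eq fun p => ?_
  change (a &&& b).testBit p = _
  rw [Nat.testBit_and, Nat.zero_testBit, Bool.and_eq_false_iff]
  obtain ⟨h₁, h₂⟩ := h p
  by_contra! h₃
  simp_all

theorem Cube.Sat.lor {Y : ℕ → Bool} {c : Cube} {a b : ℕ} (hc : c.Sat Y)
    (h : Cube.Sat Y (a, b)) : Cube.Sat Y (Nat.lor c.1 a, Nat.lor c.2 b) := by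
  intro p
  change ((c.1 ||| a).testBit p = true → _) ∧ ((c.2 ||| b).testBit p = true → _)
  rw [Nat.testBit_or, Nat.testBit_or, Bool.or_eq_true, Bool.or_eq_true]
  exact ⟨fun h' => h'.elim (hc p).1 (h p).1, fun h' => h'.elim (hc p).2 (h p).2⟩

theorem not_sat_of_refute {Y : ℕ → Bool} : ∀ (Ds : List (List Cube)) (a b : ℕ),
    refute Ds a b = true → Cube.Sat Y (a, b) → ¬ ∀ D ∈ Ds, ∃ c ∈ D, Cube.Sat Y c
  | [], _, _, h, hs, _ => by
    rw [refute, hs.land_eq_zero] at h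
    simp at h
  | D :: Ds, a, b, h, hs, hD => by
    obtain ⟨c, hc, hcs⟩ := hD D List.mem_cons_self
    simp only [refute, hs.land_eq_zero, bne_self_eq_false, Bool.false_or, List.all_eq_true,
      forceNat_eq] at h
    exact not_sat_of_refute Ds _ _ (h c hc) (hcs.lor hs)
      fun E hE => hD E (List.mem_cons_of_mem _ hE)

/-- The partial assignment with the single value `v` at position `p`. -/
def literalCube (p : ℕ) (v : Bool) : Cube := if v then (2 ^ p, 0) else (0, 2 ^ p)

theorem sat_literalCube {Y : ℕ → Bool} {p : ℕ} {v : Bool} (h : Y p = v) :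
    (literalCube p v).Sat Y := by
  intro q
  cases v <;> simp [literalCube, Nat.testBit_two_pow] <;> rintro rfl <;> exact h

/-- The word `w` written along the positions `f 0, f 1, …`. -/
def wordCube (f : ℕ → ℕ) (w : List Bool) : Cube :=
  (List.range w.length).foldr
    (fun t c => ((literalCube (f t) (w.getD t false)).1.lor c.1,
      (literalCube (f t) (w.getD t false)).2.lor c.2)) (0, 0)

theorem sat_wordCube {Y : ℕ → Bool} {f : ℕ → ℕ} {w : List Bool}
    (h : ∀ t < w.length, Y (f t) = w.getD t false) : (wordCube f w).Sat Y := by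
  refine List.foldrRecOn (List.range w.length) _ (by simp [Cube.Sat]) ?_
  intro c hc t ht
  exact (sat_literalCube (h t (List.mem_range.1 ht))).lor hc

/-- The partial assignments witnessing `Kills _ i k w`. -/
def killCubes (i k : ℕ) (w : List Bool) : List Cube :=
  ((List.range (k + 1)).filter fun a =>
      decide (a ≤ i ∧ i < a + w.length ∨ a ≤ k ∧ k < a + w.length)).map
    (fun a => wordCube (fun t => a + t) w) ++
  ((List.range (k + 1)).filter fun a =>
      decide (a < i ∧ i < a + w.length ∨ a < k - 1 ∧ k - 1 < a + w.length)).map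
    (fun a => wordCube (fun t => keptIdx i k (a + t)) w)

theorem Kills.exists_killCubes {Y : ℕ → Bool} {i k : ℕ} {w : List Bool} (hik : i < k)
    (h : Kills Y i k w) : ∃ c ∈ killCubes i k w, Cube.Sat Y c := by
  obtain ⟨a, ⟨hY, h⟩ | ⟨hY, h⟩⟩ := h
  · refine ⟨_, List.mem_append_left _ (List.mem_map_of_mem (a := a) ?_), sat_wordCube hY⟩
    simp only [List.mem_filter, List.mem_range, decide_eq_true_eq]
    exact ⟨by omega, h⟩
  · refine ⟨_, List.mem_append_right _ (List.mem_map_of_mem (a := a) ?_), sat_wordCube hY⟩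
    simp only [List.mem_filter, List.mem_range, decide_eq_true_eq]
    exact ⟨by omega, h⟩

theorem refute_killCubes : ∀ d < 12, 0 < d →
    (forceCubes (killCubes 5 (5 + d) w0000) fun C₁ =>
      forceCubes (killCubes 5 (5 + d) w1111) fun C₂ =>
        forceCubes (killCubes 5 (5 + d) w11011) fun C₃ =>
          forceCubes (killCubes 5 (5 + d) w110011) fun C₄ =>
            refute [C₁, C₂, C₃, C₄] 0 0) = true := by
  decide +kernel

/-- After any two deletions, at least one of `0000`, `1111`, `11011`, `110011`
is preserved. -/
theorem one_of_four_preserved (x y : List Bool) (hy : y ∈ D2 x) :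
    Preserved w0000 x y ∨ Preserved w1111 x y ∨
      Preserved w11011 x y ∨ Preserved w110011 x y := by
  obtain ⟨i, k, hik, hk, rfl⟩ := hy
  by_contra! hN
  obtain ⟨h₁, h₂, h₃, h₄⟩ := hN
  have hR := refute_killCubes (min (k - i) 11) (by omega) (by omega)
  simp only [forceCubes_eq] at hR
  refine not_sat_of_refute (Y := recenter (fun p => x.getD p false) i k (min (k - i) 11)) _ 0 0
    hR (by simp [Cube.Sat]) ?_
  have key : ∀ w : List Bool, w.length ≤ 6 → ¬ Preserved w x (deleteIdxs x {i, k}) → _ :=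
    fun w hw h => ((kills_of_not_preserved hik hk h).recenter hw hik).exists_killCubes (by omega)
  simp only [List.forall_mem_cons]
  exact ⟨key _ (by decide) h₁, key _ (by decide) h₂, key _ (by decide) h₃, key _ (by decide) h₄,
    by simp⟩
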